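/- Let N ≥ 1. Let (R̂_k)_{k≥1} be a sequence of axis-parallel rectangles in ℝ^N satisfying the sparseness condition vol(R̂_k ∩ ∪_{ℓ=1}^{k−1} R̂_ℓ) ≤ (1/2) vol(R̂_k) for every k. Then for every 1 < p < ∞ there is a constant B_p > 0 (depending only on p and N) such that ‖Σ_k χ_{R̂_k}‖_{L^p(ℝ^N)} ≤ B_p · vol(∪_k R̂_k)^{1/p}. -/

import Mathlib

open MeasureTheory ENNReal Set

/-- An axis-parallel rectangle in `ℝ^N`: a product of `N` nondegenerate bounded
intervals, one in each coordinate. -/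
def IsRect {N : ℕ} (R : Set (Fin N → ℝ)) : Prop :=
  ∃ a b : Fin N → ℝ, (∀ i, a i < b i) ∧ R = Set.univ.pi fun i => Set.Ioo (a i) (b i)


lemma layer_cake_pt {q : ℝ} (hq : 0 < q) (z : ℝ≥0∞) :
    ENNReal.ofReal q * ∫⁻ t in Ioi (0:ℝ), (if ENNReal.ofReal t < z then ENNReal.ofReal (t ^ (q-1)) else 0)
      = z ^ q := by
  have fin : ∀ z : ℝ≥0∞, z ≠ ∞ → ENNReal.ofReal q * ∫⁻ t in Ioi (0:ℝ), (if ENNReal.ofReal t < z then ENNReal.ofReal (t ^ (q-1)) else 0)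
      = z ^ q := by
    intro z hz
    have := lintegral_rpow_eq_lintegral_meas_lt_mul (Measure.dirac (0:ℝ)) (f := fun _ => z.toReal)
      (Filter.Eventually.of_forall fun _ => toReal_nonneg) aemeasurable_const hq
    rw [lintegral_dirac, ← ENNReal.ofReal_rpow_of_nonneg toReal_nonneg hq.le, ENNReal.ofReal_toReal hz] at this
    rw [this]
    congr 1
    refine setLIntegral_congr_fun measurableSet_Ioi fun t ht => ?_
    by_cases h : t < z.toReal
    · have h' : ENNReal.ofReal t < z := (ENNReal.ofReal_lt_iff_lt_toReal (le_of_lt ht) hz).2 h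
      simp [h, h']
    · have h' : ¬ ENNReal.ofReal t < z := fun h' => h ((ENNReal.ofReal_lt_iff_lt_toReal (le_of_lt ht) hz).1 h')
      simp [h, h']
  by_cases hz : z = ∞
  · subst hz
    rw [ENNReal.top_rpow_of_pos hq]
    refine ENNReal.eq_top_of_forall_nnreal_le fun r => ?_
    have h1 := fin (ENNReal.ofNNReal (r ^ (1/q))) (by simp)
    have h2 : (ENNReal.ofNNReal (r ^ (1/q))) ^ q = r := by
      rw [← ENNReal.coe_rpow_of_nonneg _ hq.le, ← NNReal.rpow_mul]; simp [hq.ne']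
    rw [← h2, ← h1]
    gcongr with t
    split_ifs with h h' h'
    · exact le_rfl
    · exact absurd ENNReal.ofReal_lt_top h'
    · exact zero_le
    · exact le_rfl
  · exact fin z hz

noncomputable def MX (f : ℝ → ℝ≥0∞) (x : ℝ) : ℝ≥0∞ :=
  ⨆ r : ℚ × ℚ, (Ioo (r.1:ℝ) r.2).indicator
    (fun _ => (∫⁻ y in Ioo (r.1:ℝ) r.2, f y) / volume (Ioo (r.1:ℝ) r.2)) x

lemma vol_Ioo_ne {a b : ℝ} (h : a < b) : volume (Ioo a b) ≠ 0 := by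
  rw [Real.volume_Ioo]; simpa using h

lemma MX_measurable (f : ℝ → ℝ≥0∞) : Measurable (MX f) := by
  unfold MX
  exact Measurable.iSup fun r => (measurable_const.indicator measurableSet_Ioo)

lemma MX_weak (f : ℝ → ℝ≥0∞) (t : ℝ≥0∞) (ht : t ≠ 0) (ht' : t ≠ ∞):
    t * volume {x | t < MX f x} ≤ 5 * ∫⁻ x, f x := by
  by_cases hf : ∫⁻ x, f x = ∞
  · simp [hf]
  set F : Set (ℚ × ℚ) := {r | (r.1:ℝ) < r.2 ∧
    t * volume (Ioo (r.1:ℝ) r.2) ≤ ∫⁻ y in Ioo (r.1:ℝ) r.2, f y} with hF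
  let c : ℚ × ℚ → ℝ := fun r => ((r.1:ℝ) + r.2)/2
  let ρ : ℚ × ℚ → ℝ := fun r => ((r.2:ℝ) - r.1)/2
  have hball : ∀ r, Metric.closedBall (c r) (ρ r) = Icc (r.1:ℝ) r.2 := by
    intro r; rw [Real.closedBall_eq_Icc]; simp only [c, ρ]; congr 1 <;> ring
  have hbd : ∀ r ∈ F, ρ r ≤ ((∫⁻ x, f x) / t).toReal := by
    intro r hr
    have h1 : volume (Ioo (r.1:ℝ) r.2) ≤ (∫⁻ x, f x) / t := by
      rw [ENNReal.le_div_iff_mul_le (Or.inl ht) (Or.inl ht'), mul_comm]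
      exact hr.2.trans (setLIntegral_le_lintegral _ _)
    rw [Real.volume_Ioo] at h1
    have := (ENNReal.ofReal_le_iff_le_toReal (ENNReal.div_ne_top hf ht)).1 h1
    have h2 := hr.1
    simp only [ρ]; linarith
  obtain ⟨u, huF, hdis, hcov⟩ := Vitali.exists_disjoint_subfamily_covering_enlargement_closedBall
    F c ρ _ hbd 5 (by norm_num)
  have hsub : {x | t < MX f x} ⊆ ⋃ r ∈ u, Metric.closedBall (c r) (5 * ρ r) := by
    intro x hx
    obtain ⟨r, hr⟩ := lt_iSup_iff.1 (show t < MX f x from hx)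
    by_cases hxr : x ∈ Ioo (r.1:ℝ) r.2
    · rw [indicator_of_mem hxr] at hr
      have hrF : r ∈ F := by
        refine ⟨hxr.1.trans hxr.2, ?_⟩
        exact (ENNReal.le_div_iff_mul_le (Or.inl (vol_Ioo_ne (hxr.1.trans hxr.2))) (Or.inl (by simp [Real.volume_Ioo]))).1 hr.le
      obtain ⟨b, hb, hb'⟩ := hcov r hrF
      refine mem_biUnion hb (hb'  ?_)
      rw [hball]; exact Ioo_subset_Icc_self hxr
    · rw [indicator_of_notMem hxr] at hr; exact absurd hr (by simp)
  calc t * volume {x | t < MX f x} ≤ t * ∑' r : u, volume (Metric.closedBall (c r) (5 * ρ r)) := by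
        gcongr
        exact (measure_mono hsub).trans (measure_biUnion_le _ (to_countable u) _)
    _ = 5 * ∑' r : u, t * volume (Ioo (r.1.1:ℝ) r.1.2) := by
        rw [← ENNReal.tsum_mul_left, ← ENNReal.tsum_mul_left]
        congr 1; ext r
        rw [Real.volume_closedBall, Real.volume_Ioo, mul_left_comm 5]
        congr 1
        rw [show (5:ℝ≥0∞) = ENNReal.ofReal 5 by simp, ← ENNReal.ofReal_mul (by norm_num)]
        congr 1; simp only [ρ]; ring
    _ ≤ 5 * ∑' r : u, ∫⁻ y in Ioo (r.1.1:ℝ) r.1.2, f y := by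
        gcongr with r
        exact (huF r.2).2
    _ = 5 * ∫⁻ y in ⋃ r ∈ u, Ioo (r.1:ℝ) r.2, f y := by
        rw [lintegral_biUnion (to_countable u) (fun _ _ => measurableSet_Ioo)]
        intro i hi j hj hij
        have := hdis hi hj hij
        simp only [Function.onFun, hball] at this
        exact this.mono Ioo_subset_Icc_self Ioo_subset_Icc_self
    _ ≤ _ := by gcongr; exact Measure.restrict_le_self

lemma MX_weak2 (f : ℝ → ℝ≥0∞) (hf : Measurable f) (t : ℝ≥0∞) (ht : t ≠ 0) (ht' : t ≠ ∞):
    volume {x | 2 * t < MX f x} ≤ 5 / t * ∫⁻ x, (if t < f x then f x else 0) := by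
  have h := MX_weak (fun x => if t < f x then f x else 0) t ht ht'
  have hsub : {x | 2 * t < MX f x} ⊆ {x | t < MX (fun x => if t < f x then f x else 0) x} := by
    intro x hx
    obtain ⟨r, hr⟩ := lt_iSup_iff.1 (show 2 * t < MX f x from hx)
    unfold MX
    refine lt_of_lt_of_le ?_ (le_iSup (fun r : ℚ × ℚ => (Ioo (r.1:ℝ) r.2).indicator (fun _ => (∫⁻ y in Ioo (r.1:ℝ) r.2, (if t < f y then f y else 0)) / volume (Ioo (r.1:ℝ) r.2)) x) r)
    by_cases hxr : x ∈ Ioo (r.1:ℝ) r.2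
    · rw [indicator_of_mem hxr] at hr ⊢
      have hv0 : volume (Ioo (r.1:ℝ) r.2) ≠ 0 := vol_Ioo_ne (hxr.1.trans hxr.2)
      have hvt : volume (Ioo (r.1:ℝ) r.2) ≠ ∞ := by simp [Real.volume_Ioo]
      have : (∫⁻ y in Ioo (r.1:ℝ) r.2, f y) ≤ (∫⁻ y in Ioo (r.1:ℝ) r.2, (if t < f y then f y else 0)) + t * volume (Ioo (r.1:ℝ) r.2) := by
        rw [← setLIntegral_const, ← lintegral_add_right _ measurable_const]
        refine lintegral_mono fun y => ?_
        simp only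
        split_ifs with h
        · exact le_self_add
        · simpa using h
      have h2 := ENNReal.div_le_div_right this (volume (Ioo (r.1:ℝ) r.2))
      rw [ENNReal.add_div, ENNReal.mul_div_cancel_right hv0 hvt] at h2
      have h3 := hr.trans_le h2
      rw [two_mul] at h3
      exact lt_of_add_lt_add_right h3
    · rw [indicator_of_notMem hxr] at hr; exact absurd hr (by simp)
  refine (measure_mono hsub).trans ?_
  rw [ENNReal.div_eq_inv_mul, mul_assoc, ← ENNReal.div_eq_inv_mul, ENNReal.le_div_iff_mul_le (Or.inl ht) (Or.inl ht'), mul_comm]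
  exact h

lemma MX_strong {q : ℝ} (hq : 1 < q) : ∃ C : ℝ≥0∞, C ≠ ∞ ∧ ∀ f : ℝ → ℝ≥0∞, Measurable f →
    ∫⁻ x, (MX f x) ^ q ≤ C * ∫⁻ x, f x ^ q := by
  have hq0 : 0 < q := by linarith
  have hq1 : 0 < q - 1 := by linarith
  refine ⟨ENNReal.ofReal q * (10 * ((ENNReal.ofReal (q-1))⁻¹ * 2 ^ (q-1))), ?_, ?_⟩
  · have : ENNReal.ofReal (q-1) ≠ 0 := by simpa using hq
    finiteness
  intro f hf
  have hMm := MX_measurable f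
  calc ∫⁻ x, (MX f x) ^ q
      = ∫⁻ x, ENNReal.ofReal q * ∫⁻ t in Ioi (0:ℝ), (if ENNReal.ofReal t < MX f x then ENNReal.ofReal (t ^ (q-1)) else 0) := by
        simp_rw [layer_cake_pt hq0]
    _ = ENNReal.ofReal q * ∫⁻ t in Ioi (0:ℝ), ∫⁻ x, (if ENNReal.ofReal t < MX f x then ENNReal.ofReal (t ^ (q-1)) else 0) := by
        rw [lintegral_const_mul' _ _ (by simp), lintegral_lintegral_swap]
        refine (Measurable.ite (measurableSet_lt ?_ ?_) ?_ measurable_const).aemeasurable <;> fun_prop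
    _ ≤ ENNReal.ofReal q * ∫⁻ t in Ioi (0:ℝ), ∫⁻ x, 10 * (f x * (if ENNReal.ofReal t < 2 * f x then ENNReal.ofReal (t ^ (q-1-1)) else 0)) := by
        gcongr ENNReal.ofReal q * ?_
        refine setLIntegral_mono' measurableSet_Ioi fun t ht => ?_
        have ht : 0 < t := ht
        have hw := MX_weak2 f hf (ENNReal.ofReal (t/2)) (by simpa using ht) (by simp)
        have h2 : 2 * ENNReal.ofReal (t/2) = ENNReal.ofReal t := by
          rw [show (2:ℝ≥0∞) = ENNReal.ofReal 2 by simp, ← ENNReal.ofReal_mul (by norm_num)]; congr 1; ring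
        rw [h2] at hw
        have hl : ∫⁻ x, (if ENNReal.ofReal t < MX f x then ENNReal.ofReal (t ^ (q-1)) else 0)
            = ENNReal.ofReal (t ^ (q-1)) * volume {x | ENNReal.ofReal t < MX f x} := by
          rw [← lintegral_indicator_const (measurableSet_lt measurable_const hMm)]
          refine lintegral_congr fun x => ?_
          simp [indicator_apply]
        rw [hl]
        refine (mul_le_mul_right hw _).trans_eq ?_
        rw [← mul_assoc, ← lintegral_const_mul' _ _ (by
          have : ENNReal.ofReal (t/2) ≠ 0 := by simpa using ht
          finiteness)]
        refine lintegral_congr fun x => ?_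
        have hiff : ENNReal.ofReal (t/2) < f x ↔ ENNReal.ofReal t < 2 * f x := by
          rw [← h2]; exact (ENNReal.mul_lt_mul_iff_right (by simp) (by simp)).symm
        simp only [hiff]
        split_ifs with h
        · rw [mul_comm (f x), ← mul_assoc 10]
          congr 1
          rw [show (5:ℝ≥0∞) = ENNReal.ofReal 5 by simp, show (10:ℝ≥0∞) = ENNReal.ofReal 10 by simp,
            ← ENNReal.ofReal_div_of_pos (by positivity), ← ENNReal.ofReal_mul (by positivity),
            ← ENNReal.ofReal_mul (by positivity)]
          congr 1
          rw [Real.rpow_sub_one ht.ne' (q-1)]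
          field_simp; norm_num
        · simp
    _ = ENNReal.ofReal q * ∫⁻ x, ∫⁻ t in Ioi (0:ℝ), 10 * (f x * (if ENNReal.ofReal t < 2 * f x then ENNReal.ofReal (t ^ (q-1-1)) else 0)) := by
        rw [lintegral_lintegral_swap]
        refine Measurable.aemeasurable ?_
        refine Measurable.const_mul (Measurable.mul (by fun_prop) (Measurable.ite (measurableSet_lt ?_ ?_) ?_ measurable_const)) _ <;> fun_prop
    _ = _ := by
        have hm : Measurable fun x => f x ^ q := by fun_prop
        rw [mul_assoc, ← lintegral_const_mul _ hm]
        congr 1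
        refine lintegral_congr fun x => ?_
        have hmm : Measurable fun t : ℝ => (if ENNReal.ofReal t < 2 * f x then ENNReal.ofReal (t ^ (q-1-1)) else 0) := by
          refine Measurable.ite (measurableSet_lt ?_ ?_) ?_ measurable_const <;> fun_prop
        rw [lintegral_const_mul _ (hmm.const_mul _), lintegral_const_mul _ hmm]
        have := layer_cake_pt hq1 (2 * f x)
        have h3 : ∫⁻ t in Ioi (0:ℝ), (if ENNReal.ofReal t < 2 * f x then ENNReal.ofReal (t ^ (q-1-1)) else 0)
          = (ENNReal.ofReal (q-1))⁻¹ * (2 * f x) ^ (q-1) := by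
          rw [← this, ← mul_assoc, ENNReal.inv_mul_cancel (by simpa using hq) (by simp), one_mul]
        rw [h3, ENNReal.mul_rpow_of_nonneg _ _ hq1.le]
        have h4 : f x ^ q = f x * f x ^ (q-1) := by
          conv_lhs => rw [show q = 1 + (q-1) by ring, ENNReal.rpow_add_of_nonneg _ _ zero_le_one hq1.le, ENNReal.rpow_one]
        rw [h4]; ring

lemma MX_ge (f : ℝ → ℝ≥0∞) {a b x : ℝ} (hx : x ∈ Ioo a b) :
    ∫⁻ y in Ioo a b, f y ≤ ENNReal.ofReal (b - a) * (2 * MX f x) := by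
  have hab : a < b := hx.1.trans hx.2
  obtain ⟨a', h1, h2⟩ := exists_rat_btwn (show a - (b-a)/2 < a by linarith)
  obtain ⟨b', h3, h4⟩ := exists_rat_btwn (show b < b + (b-a)/2 by linarith)
  have hx' : x ∈ Ioo (a':ℝ) b' := ⟨h2.trans hx.1, hx.2.trans h3⟩
  have h5 : (∫⁻ y in Ioo (a':ℝ) b', f y) / volume (Ioo (a':ℝ) b') ≤ MX f x := by
    refine le_trans (le_of_eq ?_) (le_iSup _ (a', b'))
    rw [indicator_of_mem hx']
  rw [ENNReal.div_le_iff (vol_Ioo_ne (hx'.1.trans hx'.2)) (by simp [Real.volume_Ioo]), Real.volume_Ioo] at h5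
  calc ∫⁻ y in Ioo a b, f y ≤ ∫⁻ y in Ioo (a':ℝ) b', f y :=
        lintegral_mono_set (Ioo_subset_Ioo h2.le h3.le)
    _ ≤ _ := h5
    _ ≤ MX f x * ENNReal.ofReal (2 * (b-a)) := by gcongr; linarith
    _ = _ := by rw [ENNReal.ofReal_mul (by norm_num)]; simp; ring

/-- directional maximal function -/
noncomputable def MD {N : ℕ} (i : Fin N) (f : (Fin N → ℝ) → ℝ≥0∞) (x : Fin N → ℝ) : ℝ≥0∞ :=
  MX (fun y => f (Function.update x i y)) (x i)

lemma MD_measurable {N : ℕ} (i : Fin N) (f : (Fin N → ℝ) → ℝ≥0∞) (hf : Measurable f) :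
    Measurable (MD i f) := by
  unfold MD MX
  refine Measurable.iSup fun r => ?_
  have h1 : Measurable fun x : Fin N → ℝ => ∫⁻ y in Ioo (r.1:ℝ) r.2, f (Function.update x i y) := by
    have := hf.lmarginal (s := {i}) (fun _ : Fin N => (volume : Measure ℝ).restrict (Ioo (r.1:ℝ) r.2))
    rwa [lmarginal_singleton] at this
  have h2 : MeasurableSet {x : Fin N → ℝ | x i ∈ Ioo (r.1:ℝ) r.2} :=
    measurableSet_Ioo.preimage (measurable_pi_apply i)
  have := (h1.div_const (volume (Ioo (r.1:ℝ) r.2))).indicator h2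
  convert this using 1
  ext x
  by_cases hx : x i ∈ Ioo (r.1:ℝ) r.2 <;> simp only [indicator_apply, hx, mem_setOf_eq]

lemma MD_strong {N : ℕ} {q : ℝ} (hq : 1 < q) : ∃ C : ℝ≥0∞, C ≠ ∞ ∧
    ∀ (i : Fin N) (f : (Fin N → ℝ) → ℝ≥0∞), Measurable f →
    ∫⁻ x, (MD i f x) ^ q ≤ C * ∫⁻ x, f x ^ q := by
  obtain ⟨C, hC, h⟩ := MX_strong hq
  refine ⟨C, hC, fun i f hf => ?_⟩
  have hm := MD_measurable i f hf
  rw [← lintegral_const_mul _ (hf.pow_const q)]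
  rw [volume_pi]
  refine lintegral_le_of_lmarginal_le {i} (hm.pow_const q) ((hf.pow_const q).const_mul C) ?_
  rw [lmarginal_singleton, lmarginal_singleton]
  intro x
  have hfu : Measurable fun y => f (Function.update x i y) := hf.comp (measurable_update x)
  have := h (fun y => f (Function.update x i y)) hfu
  simp only [MD, Function.update_idem, Function.update_self]
  rw [lintegral_const_mul _ (hfu.pow_const q)]
  exact this

lemma strong_max {N : ℕ} {q : ℝ} (hq : 1 < q) (s : Finset (Fin N)) : ∃ C : ℝ≥0∞, C ≠ ∞ ∧
    ∀ (f : (Fin N → ℝ) → ℝ≥0∞), Measurable f → ∃ G : (Fin N → ℝ) → ℝ≥0∞, Measurable G ∧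
      ∫⁻ x, G x ^ q ≤ C * ∫⁻ x, f x ^ q ∧
      ∀ a b : Fin N → ℝ, ∀ x ∈ Set.univ.pi fun i => Ioo (a i) (b i),
        (∫⋯∫⁻_s, f ∂(fun i => (volume : Measure ℝ).restrict (Ioo (a i) (b i)))) x
          ≤ (∏ i ∈ s, ENNReal.ofReal (b i - a i)) * G x := by
  have hq0 : 0 < q := by linarith
  obtain ⟨C₁, hC₁, h1⟩ := MD_strong (N := N) hq
  induction s using Finset.induction with
  | empty => exact ⟨1, by simp, fun f hf => ⟨f, hf, by simp, fun a b x hx => by simp⟩⟩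
  | insert i s hi ih =>
    obtain ⟨C, hC, h⟩ := ih
    refine ⟨2 ^ q * (C₁ * C), by finiteness, fun f hf => ?_⟩
    obtain ⟨G, hG, hGi, hGb⟩ := h f hf
    have hm := MD_measurable i G hG
    refine ⟨fun x => 2 * MD i G x, hm.const_mul 2, ?_, ?_⟩
    · simp_rw [ENNReal.mul_rpow_of_nonneg _ _ hq0.le]
      rw [lintegral_const_mul _ (hm.pow_const q), mul_assoc, mul_assoc]
      gcongr
      exact (h1 i G hG).trans (by gcongr)
    · intro a b x hx
      rw [lmarginal_insert _ hf hi, Finset.prod_insert hi]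
      calc _ ≤ ∫⁻ y in Ioo (a i) (b i), (∏ i ∈ s, ENNReal.ofReal (b i - a i)) * G (Function.update x i y) := by
            refine setLIntegral_mono' measurableSet_Ioo fun y hy => hGb a b _ ?_
            intro j _
            by_cases hj : j = i
            · subst hj; simpa using hy
            · rw [Function.update_of_ne hj]; exact hx j trivial
        _ = (∏ i ∈ s, ENNReal.ofReal (b i - a i)) * ∫⁻ y in Ioo (a i) (b i), G (Function.update x i y) :=
            lintegral_const_mul _ (hG.comp (measurable_update x))
        _ ≤ (∏ i ∈ s, ENNReal.ofReal (b i - a i)) * (ENNReal.ofReal (b i - a i) * (2 * MD i G x)) := by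
            gcongr
            exact MX_ge _ (hx i trivial)
        _ = _ := by ring

lemma strong_max_rect {N : ℕ} {q : ℝ} (hq : 1 < q) : ∃ C : ℝ≥0∞, C ≠ ∞ ∧
    ∀ (f : (Fin N → ℝ) → ℝ≥0∞), Measurable f → ∃ G : (Fin N → ℝ) → ℝ≥0∞, Measurable G ∧
      ∫⁻ x, G x ^ q ≤ C * ∫⁻ x, f x ^ q ∧
      ∀ R : Set (Fin N → ℝ), IsRect R → ∀ x ∈ R, ∫⁻ y in R, f y ≤ volume R * G x := by
  obtain ⟨C, hC, h⟩ := strong_max (N := N) hq Finset.univ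
  refine ⟨C, hC, fun f hf => ?_⟩
  obtain ⟨G, hG, hGi, hGb⟩ := h f hf
  refine ⟨G, hG, hGi, ?_⟩
  rintro R ⟨a, b, hab, rfl⟩ x hx
  have := hGb a b x hx
  rw [lmarginal_univ] at this
  rw [volume_pi, Measure.restrict_pi_pi, Measure.pi_pi]
  simpa only [Real.volume_Ioo] using this

lemma IsRect.measurableSet {N : ℕ} {R : Set (Fin N → ℝ)} (h : IsRect R) : MeasurableSet R := by
  obtain ⟨a, b, hab, rfl⟩ := h
  exact MeasurableSet.univ_pi fun i => measurableSet_Ioo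

lemma IsRect.volume_ne_top {N : ℕ} {R : Set (Fin N → ℝ)} (h : IsRect R) : volume R ≠ ∞ := by
  obtain ⟨a, b, hab, rfl⟩ := h
  rw [volume_pi, Measure.pi_pi]
  exact ENNReal.prod_ne_top fun i _ => by simp [Real.volume_Ioo]

lemma finite_bound {N : ℕ} {p q : ℝ} (hpq : p.HolderConjugate q) {C : ℝ≥0∞}
    (hC : ∀ (f : (Fin N → ℝ) → ℝ≥0∞), Measurable f → ∃ G : (Fin N → ℝ) → ℝ≥0∞, Measurable G ∧
      ∫⁻ x, G x ^ q ≤ C * ∫⁻ x, f x ^ q ∧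
      ∀ R : Set (Fin N → ℝ), IsRect R → ∀ x ∈ R, ∫⁻ y in R, f y ≤ volume R * G x)
    (R : ℕ → Set (Fin N → ℝ)) (hR : ∀ k, IsRect (R k))
    (hs : ∀ k : ℕ, volume (R k ∩ ⋃ l ∈ Finset.range k, R l) ≤ volume (R k) / 2) (n : ℕ) :
    ∫⁻ x, (∑ k ∈ Finset.range n, (R k).indicator (fun _ => (1 : ℝ≥0∞)) x) ^ p ≤
      (2 * C ^ (1/q)) ^ p * volume (⋃ k, R k) := by
  have hp0 : 0 < p := hpq.pos
  have hq0 : 0 < q := hpq.symm.pos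
  have hp1 : 0 < p - 1 := sub_pos.2 hpq.lt
  have hRm := fun k => (hR k).measurableSet
  set S : (Fin N → ℝ) → ℝ≥0∞ := fun x => ∑ k ∈ Finset.range n, (R k).indicator (fun _ => (1 : ℝ≥0∞)) x with hS
  have hSm : Measurable S := Finset.measurable_sum _ fun k _ => measurable_const.indicator (hRm k)
  set X := ∫⁻ x, S x ^ p with hX
  set U := ⋃ k, R k with hU
  have hUm : MeasurableSet U := MeasurableSet.iUnion hRm
  -- finiteness
  have hXfin : X ≠ ∞ := by
    have hb : ∀ x, S x ^ p ≤ (n:ℝ≥0∞) ^ p * S x := by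
      intro x
      by_cases h0 : S x = 0
      · simp [h0, hp0]
      obtain ⟨k, hk, hk'⟩ : ∃ k ∈ Finset.range n, (R k).indicator (fun _ => (1 : ℝ≥0∞)) x ≠ 0 := by
        by_contra! hcon
        exact h0 (Finset.sum_eq_zero hcon)
      have h1 : 1 ≤ S x := by
        have hxk : x ∈ R k := mem_of_indicator_ne_zero hk'
        calc (1:ℝ≥0∞) = (R k).indicator (fun _ => (1 : ℝ≥0∞)) x := by rw [indicator_of_mem hxk]
          _ ≤ S x := Finset.single_le_sum (f := fun k => (R k).indicator (fun _ => (1 : ℝ≥0∞)) x) (fun _ _ => zero_le) hk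
      have h2 : S x ≤ n := by
        calc S x ≤ ∑ k ∈ Finset.range n, 1 := Finset.sum_le_sum fun k _ => indicator_le_self' (fun _ _ => zero_le) x
          _ = n := by simp
      calc S x ^ p ≤ (n:ℝ≥0∞) ^ p * 1 := by rw [mul_one]; gcongr
        _ ≤ _ := by gcongr
    refine ne_top_of_le_ne_top ?_ (lintegral_mono hb)
    rw [lintegral_const_mul _ hSm, lintegral_finsetSum _ fun k _ => measurable_const.indicator (hRm k)]
    refine ENNReal.mul_ne_top (by finiteness) (ENNReal.sum_ne_top.2 fun k _ => ?_)
    rw [lintegral_indicator_const (hRm k), one_mul]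
    exact (hR k).volume_ne_top
  let φ : (Fin N → ℝ) → ℝ≥0∞ := fun x => S x ^ (p-1)
  have hφm : Measurable φ := hSm.pow_const _
  obtain ⟨G, hG, hGi, hGb⟩ := hC φ hφm
  have hφq : ∫⁻ x, φ x ^ q = X := by
    refine lintegral_congr fun x => ?_
    simp only [φ]
    rw [← ENNReal.rpow_mul, hpq.sub_one_mul_conj]
  rw [hφq] at hGi
  let E : ℕ → Set (Fin N → ℝ) := fun k => R k \ ⋃ l ∈ Finset.range k, R l
  have hPm : ∀ k, MeasurableSet (⋃ l ∈ Finset.range k, R l) := fun k =>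
    Finset.measurableSet_biUnion _ fun l _ => hRm l
  have hEm : ∀ k, MeasurableSet (E k) := fun k => (hRm k).diff (hPm k)
  have hEdis : Pairwise (Function.onFun Disjoint E) := by
    have key : ∀ i j, i < j → Disjoint (E i) (E j) := by
      intro i j hij
      rw [Set.disjoint_left]
      intro x hxi hxj
      exact hxj.2 (mem_biUnion (Finset.mem_coe.2 (Finset.mem_range.2 hij)) hxi.1)
    intro i j hij
    rcases lt_or_gt_of_ne hij with h | h
    · exact key i j h
    · exact (key j i h).symm
  have hEv : ∀ k, volume (R k) ≤ 2 * volume (E k) := by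
    intro k
    have h1 := measure_inter_add_diff (μ := volume) (R k) (hPm k)
    have h2 : volume (R k) / 2 + volume (R k) / 2 ≤ volume (R k) / 2 + volume (E k) := by
      rw [ENNReal.add_halves]
      conv_lhs => rw [← h1]
      gcongr
      exact hs k
    have h3 : volume (R k) / 2 ≤ volume (E k) :=
      (ENNReal.add_le_add_iff_left (ENNReal.div_ne_top (hR k).volume_ne_top (by simp))).1 h2
    rw [← ENNReal.add_halves (volume (R k)), two_mul]
    gcongr
  have hterm : ∀ k, ∫⁻ y in R k, φ y ≤ 2 * ∫⁻ x in E k, G x := by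
    intro k
    have hv0 : volume (R k) ≠ 0 := by
      obtain ⟨a, b, hab, h⟩ := hR k
      rw [h, volume_pi, Measure.pi_pi]
      exact Finset.prod_ne_zero_iff.2 fun i _ => vol_Ioo_ne (hab i)
    have hvt := (hR k).volume_ne_top
    set A := (∫⁻ y in R k, φ y) / volume (R k) with hA
    have hA1 : A * volume (R k) = ∫⁻ y in R k, φ y := ENNReal.div_mul_cancel hv0 hvt
    calc ∫⁻ y in R k, φ y = A * volume (R k) := hA1.symm
      _ ≤ A * (2 * volume (E k)) := by gcongr; exact hEv k
      _ = 2 * ∫⁻ x in E k, A := by rw [setLIntegral_const]; ring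
      _ ≤ 2 * ∫⁻ x in E k, G x := by
        gcongr 2 * ?_
        refine setLIntegral_mono' (hEm k) fun x hx => ?_
        rw [hA, ENNReal.div_le_iff hv0 hvt, mul_comm]
        exact hGb _ (hR k) x hx.1
  have hmain : X ≤ 2 * ∫⁻ x in U, G x := by
    calc X = ∫⁻ x, ∑ k ∈ Finset.range n, (R k).indicator φ x := by
          refine lintegral_congr fun x => ?_
          have : S x ^ p = S x * φ x := by
            simp only [φ]
            conv_lhs => rw [show p = 1 + (p-1) by ring, ENNReal.rpow_add_of_nonneg _ _ zero_le_one hp1.le, ENNReal.rpow_one]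
          rw [this, hS, Finset.sum_mul]
          refine Finset.sum_congr rfl fun k _ => ?_
          by_cases hx : x ∈ R k <;> simp [hx]
      _ = ∑ k ∈ Finset.range n, ∫⁻ y in R k, φ y := by
          rw [lintegral_finsetSum _ fun k _ => hφm.indicator (hRm k)]
          exact Finset.sum_congr rfl fun k _ => lintegral_indicator (hRm k) _
      _ ≤ ∑ k ∈ Finset.range n, 2 * ∫⁻ x in E k, G x := Finset.sum_le_sum fun k _ => hterm k
      _ ≤ ∑' k, 2 * ∫⁻ x in E k, G x := ENNReal.sum_le_tsum _
      _ = 2 * ∫⁻ x in ⋃ k, E k, G x := by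
          rw [ENNReal.tsum_mul_left, lintegral_iUnion hEm hEdis]
      _ ≤ _ := by
          gcongr 2 * ?_
          exact lintegral_mono_set (iUnion_mono fun k => diff_subset)
  have hholder : ∫⁻ x in U, G x ≤ (C * X) ^ (1/q) * volume U ^ (1/p) := by
    have h := ENNReal.lintegral_mul_le_Lp_mul_Lq (volume.restrict U) hpq.symm hG.aemeasurable
      (aemeasurable_const (b := (1:ℝ≥0∞)))
    simp only [Pi.mul_apply, mul_one, ENNReal.one_rpow, lintegral_one, Measure.restrict_apply_univ] at h
    refine h.trans ?_
    gcongr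
    exact (setLIntegral_le_lintegral _ _).trans hGi
  by_cases hX0 : X = 0
  · rw [hX0]; exact zero_le
  have hfin : X ^ (1/p) ≤ 2 * C ^ (1/q) * volume U ^ (1/p) := by
    have h1 : X ^ (1/q) * X ^ (1/p) ≤ X ^ (1/q) * (2 * C ^ (1/q) * volume U ^ (1/p)) := by
      rw [← ENNReal.rpow_add _ _ hX0 hXfin]
      have : 1/q + 1/p = 1 := by
        have := hpq.inv_add_inv_eq_one
        rw [one_div, one_div, add_comm]; exact this
      rw [this, ENNReal.rpow_one]
      refine (hmain.trans (mul_le_mul_right hholder 2)).trans_eq ?_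
      rw [ENNReal.mul_rpow_of_nonneg _ _ (by positivity)]
      ring
    exact (ENNReal.mul_le_mul_iff_right (by simp [hX0, hXfin]) (ENNReal.rpow_ne_top_of_nonneg (by positivity) hXfin)).1 h1
  have h2 := ENNReal.rpow_le_rpow hfin hp0.le
  rw [ENNReal.mul_rpow_of_nonneg _ _ hp0.le, ← ENNReal.rpow_mul, ← ENNReal.rpow_mul, one_div_mul_cancel hp0.ne',
    ENNReal.rpow_one, ENNReal.rpow_one] at h2
  exact h2

/-- If a sequence of axis-parallel rectangles `R̂_k` satisfies the sparseness condition
`vol(R̂_k ∩ ∪_{ℓ<k} R̂_ℓ) ≤ (1/2) vol(R̂_k)` for every `k`, then for every `1 < p < ∞`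
one has `‖Σ_k χ_{R̂_k}‖_{L^p} ≤ B_p vol(∪_k R̂_k)^(1/p)` with `B_p` depending only on
`p` and `N`. -/
theorem sparse_rectangles_sum_indicator_Lp (N : ℕ) (hN : 1 ≤ N) (p : ℝ) (hp : 1 < p) :
    ∃ B : ℝ, 0 < B ∧
      ∀ R : ℕ → Set (Fin N → ℝ), (∀ k, IsRect (R k)) →
        (∀ k : ℕ, volume (R k ∩ ⋃ l ∈ Finset.range k, R l) ≤ volume (R k) / 2) →
        (∫⁻ x, (∑' k : ℕ, (R k).indicator (fun _ => (1 : ℝ≥0∞)) x) ^ p) ^ (1 / p) ≤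
          ENNReal.ofReal B * volume (⋃ k, R k) ^ (1 / p) := by
  have hpq : p.HolderConjugate (p.conjExponent) := Real.HolderConjugate.conjExponent hp
  have hp0 : 0 < p := hpq.pos
  obtain ⟨C, hCt, hC⟩ := strong_max_rect (N := N) hpq.symm.lt
  have hDt : 2 * C ^ (1 / p.conjExponent) ≠ ∞ :=
    ENNReal.mul_ne_top (by simp) (ENNReal.rpow_ne_top_of_nonneg (one_div_nonneg.2 hpq.symm.nonneg) hCt)
  refine ⟨(2 * C ^ (1 / p.conjExponent)).toReal + 1, by positivity, fun R hR hs => ?_⟩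
  have hfb := finite_bound hpq hC R hR hs
  have hlim : ∫⁻ x, (∑' k : ℕ, (R k).indicator (fun _ => (1 : ℝ≥0∞)) x) ^ p ≤
      (2 * C ^ (1 / p.conjExponent)) ^ p * volume (⋃ k, R k) := by
    have heq : ∀ x, (∑' k : ℕ, (R k).indicator (fun _ => (1 : ℝ≥0∞)) x) ^ p =
        ⨆ n : ℕ, (∑ k ∈ Finset.range n, (R k).indicator (fun _ => (1 : ℝ≥0∞)) x) ^ p := by
      intro x
      rw [ENNReal.tsum_eq_iSup_nat]
      exact (ENNReal.orderIsoRpow p hp0).map_iSup _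
    simp_rw [heq]
    rw [lintegral_iSup]
    · exact iSup_le hfb
    · intro n
      exact (Finset.measurable_sum _ fun k _ => measurable_const.indicator (hR k).measurableSet).pow_const _
    · intro m n hmn x
      simp only
      gcongr
  have h2 := ENNReal.rpow_le_rpow hlim (one_div_nonneg.2 hp0.le)
  rw [ENNReal.mul_rpow_of_nonneg _ _ (one_div_nonneg.2 hp0.le), ← ENNReal.rpow_mul, mul_one_div_cancel hp0.ne', ENNReal.rpow_one] at h2
  refine h2.trans ?_
  gcongr
  rw [← ENNReal.ofReal_toReal hDt, ENNReal.toReal_ofReal ENNReal.toReal_nonneg]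
  exact ENNReal.ofReal_le_ofReal (by linarith)
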